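/- arXiv:0710.5368 — 3 statements merged into one kernel-verified Lean document; each statement's English description precedes it below -/
import Mathlib

section
/- Let R be a (possibly noncommutative) unital ring and let M be the 3×3 block matrix M = ((A₀,B₁,C₂),(C₀,A₁,B₂),(B₀,C₁,A₂)) where A₀ is m₁×m₁, A₁ is m₂×m₂, A₂ is m₃×m₃, B₁ is m₁×m₂, C₂ is m₁×m₃, C₀ is m₂×m₁, B₂ is m₂×m₃, B₀ is m₃×m₁, C₁ is m₃×m₂, all with entries in R. Assume A₀, A₁, A₂ are invertible, assume D₂ := A₂ − C₁A₁⁻¹B₂, D₀ := A₀ − C₂A₂⁻¹B₀ and D₁ := A₁ − C₀A₀⁻¹B₁ are invertible, and assume the three matrices E₀ := A₀ − C₂D₂⁻¹(B₀ − C₁A₁⁻¹C₀) − B₁A₁⁻¹[C₀ − B₂D₂⁻¹(B₀ − C₁A₁⁻¹C₀)], E₁ := A₁ − C₀D₀⁻¹(B₁ − C₂A₂⁻¹C₁) − B₂A₂⁻¹[C₁ − B₀D₀⁻¹(B₁ − C₂A₂⁻¹C₁)], E₂ := A₂ − C₁D₁⁻¹(B₂ − C₀A₀⁻¹C₂) −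 B₀A₀⁻¹[C₂ − B₁D₁⁻¹(B₂ − C₀A₀⁻¹C₂)] are invertible. Set A₀' = E₀⁻¹, A₁' = E₁⁻¹, A₂' = E₂⁻¹, B₀' = −D₂⁻¹(B₀ − C₁A₁⁻¹C₀)A₀', C₀' = −A₁⁻¹[C₀ − B₂D₂⁻¹(B₀ − C₁A₁⁻¹C₀)]A₀', B₁' = −D₀⁻¹(B₁ − C₂A₂⁻¹C₁)A₁', C₁' = −A₂⁻¹[C₁ − B₀D₀⁻¹(B₁ − C₂A₂⁻¹C₁)]A₁', B₂' = −D₁⁻¹(B₂ − C₀A₀⁻¹C₂)A₂', C₂' = −A₀⁻¹[C₂ − B₁D₁⁻¹(B₂ − C₀A₀⁻¹C₂)]A₂'. Then the block matrix N = ((A₀',B₁',C₂'),(C₀',A₁',B₂'),(B₀',C₁',A₂')) satisfies M · N = 1 (the identity matrix). -/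
/-- The 3×3 block matrix `((A₀,B₁,C₂),(C₀,A₁,B₂),(B₀,C₁,A₂))`. -/
def block3 {R : Type*} {m₁ m₂ m₃ : ℕ}
    (A₀ : Matrix (Fin m₁) (Fin m₁) R) (B₁ : Matrix (Fin m₁) (Fin m₂) R)
    (C₂ : Matrix (Fin m₁) (Fin m₃) R)
    (C₀ : Matrix (Fin m₂) (Fin m₁) R) (A₁ : Matrix (Fin m₂) (Fin m₂) R)
    (B₂ : Matrix (Fin m₂) (Fin m₃) R)
    (B₀ : Matrix (Fin m₃) (Fin m₁) R) (C₁ : Matrix (Fin m₃) (Fin m₂) R)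
    (A₂ : Matrix (Fin m₃) (Fin m₃) R) :
    Matrix (Fin m₁ ⊕ Fin m₂ ⊕ Fin m₃) (Fin m₁ ⊕ Fin m₂ ⊕ Fin m₃) R :=
  Matrix.of fun I J =>
    match I, J with
    | .inl i, .inl j => A₀ i j
    | .inl i, .inr (.inl j) => B₁ i j
    | .inl i, .inr (.inr j) => C₂ i j
    | .inr (.inl i), .inl j => C₀ i j
    | .inr (.inl i), .inr (.inl j) => A₁ i j
    | .inr (.inl i), .inr (.inr j) => B₂ i j
    | .inr (.inr i), .inl j => B₀ i j
    | .inr (.inr i), .inr (.inl j) => C₁ i j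
    | .inr (.inr i), .inr (.inr j) => A₂ i j

namespace Matrix

variable {R p q s : Type*} [Ring R] [Fintype p] [Fintype q] [Fintype s]

theorem pivot_row_mul_eq_zero [DecidableEq q] {A : Matrix q q R} [Invertible A] (W : Matrix q p R)
    (U : Matrix q s R) (D : Matrix s s R) (Y : Matrix s p R) (Z : Matrix p p R) :
    W * Z + A * -(⅟A * (W - U * D * Y) * Z) + U * -(D * Y * Z) = 0 := by
  simp only [Matrix.mul_neg, Matrix.mul_assoc, Matrix.mul_invOf_cancel_left, Matrix.sub_mul]
  abel

theorem schur_row_mul_eq_zero [DecidableEq q] [DecidableEq s] {A : Matrix q q R}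
    [Invertible A] (V : Matrix s p R) (T : Matrix s q R) (S : Matrix s s R)
    (W : Matrix q p R) (U : Matrix q s R) [Invertible (S - T * ⅟A * U)] (Z : Matrix p p R) :
    V * Z + T * -(⅟A * (W - U * ⅟(S - T * ⅟A * U) * (V - T * ⅟A * W)) * Z) +
      S * -(⅟(S - T * ⅟A * U) * (V - T * ⅟A * W) * Z) = 0 := by
  have h : (S - T * ⅟A * U) * (⅟(S - T * ⅟A * U) * ((V - T * ⅟A * W) * Z)) =
      (V - T * ⅟A * W) * Z := Matrix.mul_invOf_cancel_left _ _
  generalize ⅟(S - T * ⅟A * U) = D at h ⊢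
  rw [Matrix.sub_mul S] at h
  simp only [Matrix.mul_neg, Matrix.mul_assoc, Matrix.sub_mul, Matrix.mul_sub] at h ⊢
  rw [← sub_eq_zero, ← neg_eq_zero] at h
  rw [← h]
  abel

theorem diagonal_row_mul_eq_one [DecidableEq p] (P : Matrix p p R) (G : Matrix p q R)
    (H : Matrix p s R) (A : Matrix q q R) (W : Matrix q p R) (D : Matrix s s R)
    (Y : Matrix s p R)
    [Invertible (P - H * D * Y - G * A * W)] :
    P * ⅟(P - H * D * Y - G * A * W) + G * -(A * W * ⅟(P - H * D * Y - G * A * W)) +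
      H * -(D * Y * ⅟(P - H * D * Y - G * A * W)) = 1 := by
  have h := mul_invOf_self (P - H * D * Y - G * A * W)
  generalize ⅟(P - H * D * Y - G * A * W) = Z at h ⊢
  rw [← h]
  simp only [Matrix.mul_neg, Matrix.mul_assoc, Matrix.sub_mul]
  abel

end Matrix

section block3

variable {R : Type*} {m₁ m₂ m₃ : ℕ}
    (A₀ A₀' : Matrix (Fin m₁) (Fin m₁) R) (B₁ B₁' : Matrix (Fin m₁) (Fin m₂) R)
    (C₂ C₂' : Matrix (Fin m₁) (Fin m₃) R)
    (C₀ C₀' : Matrix (Fin m₂) (Fin m₁) R) (A₁ A₁' : Matrix (Fin m₂) (Fin m₂) R)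
    (B₂ B₂' : Matrix (Fin m₂) (Fin m₃) R)
    (B₀ B₀' : Matrix (Fin m₃) (Fin m₁) R) (C₁ C₁' : Matrix (Fin m₃) (Fin m₂) R)
    (A₂ A₂' : Matrix (Fin m₃) (Fin m₃) R)

theorem block3_mul [NonUnitalNonAssocSemiring R] :
    block3 A₀ B₁ C₂ C₀ A₁ B₂ B₀ C₁ A₂ * block3 A₀' B₁' C₂' C₀' A₁' B₂' B₀' C₁' A₂' =
      block3
        (A₀ * A₀' + B₁ * C₀' + C₂ * B₀') (A₀ * B₁' + B₁ * A₁' + C₂ * C₁')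
        (A₀ * C₂' + B₁ * B₂' + C₂ * A₂')
        (C₀ * A₀' + A₁ * C₀' + B₂ * B₀') (C₀ * B₁' + A₁ * A₁' + B₂ * C₁')
        (C₀ * C₂' + A₁ * B₂' + B₂ * A₂')
        (B₀ * A₀' + C₁ * C₀' + A₂ * B₀') (B₀ * B₁' + C₁ * A₁' + A₂ * C₁')
        (B₀ * C₂' + C₁ * B₂' + A₂ * A₂') := by
  ext (i | i | i) (j | j | j) <;> simp [block3, Matrix.mul_apply, add_assoc]

theorem block3_one [Zero R] [One R] :
    block3 (1 : Matrix (Fin m₁) (Fin m₁) R) 0 0 0 (1 : Matrix (Fin m₂) (Fin m₂) R) 0 0 0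
      (1 : Matrix (Fin m₃) (Fin m₃) R) = 1 := by
  ext (i | i | i) (j | j | j) <;> simp [block3, Matrix.one_apply]

end block3

/-- Explicit block inversion of the matrix `M = ((A₀,B₁,C₂),(C₀,A₁,B₂),(B₀,C₁,A₂))`
over a possibly noncommutative ring. -/
theorem block3_mul_inv_eq_one {R : Type*} [Ring R] {m₁ m₂ m₃ : ℕ}
    (A₀ : Matrix (Fin m₁) (Fin m₁) R) (B₁ : Matrix (Fin m₁) (Fin m₂) R)
    (C₂ : Matrix (Fin m₁) (Fin m₃) R)
    (C₀ : Matrix (Fin m₂) (Fin m₁) R) (A₁ : Matrix (Fin m₂) (Fin m₂) R)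
    (B₂ : Matrix (Fin m₂) (Fin m₃) R)
    (B₀ : Matrix (Fin m₃) (Fin m₁) R) (C₁ : Matrix (Fin m₃) (Fin m₂) R)
    (A₂ : Matrix (Fin m₃) (Fin m₃) R)
    [Invertible A₀] [Invertible A₁] [Invertible A₂]
    -- D₂, D₀, D₁ invertible
    [Invertible (A₂ - C₁ * ⅟A₁ * B₂)]
    [Invertible (A₀ - C₂ * ⅟A₂ * B₀)]
    [Invertible (A₁ - C₀ * ⅟A₀ * B₁)]
    -- E₀, E₁, E₂ invertible
    [Invertible (A₀ - C₂ * ⅟(A₂ - C₁ * ⅟A₁ * B₂) * (B₀ - C₁ * ⅟A₁ * C₀)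
      - B₁ * ⅟A₁ * (C₀ - B₂ * ⅟(A₂ - C₁ * ⅟A₁ * B₂) * (B₀ - C₁ * ⅟A₁ * C₀)))]
    [Invertible (A₁ - C₀ * ⅟(A₀ - C₂ * ⅟A₂ * B₀) * (B₁ - C₂ * ⅟A₂ * C₁)
      - B₂ * ⅟A₂ * (C₁ - B₀ * ⅟(A₀ - C₂ * ⅟A₂ * B₀) * (B₁ - C₂ * ⅟A₂ * C₁)))]
    [Invertible (A₂ - C₁ * ⅟(A₁ - C₀ * ⅟A₀ * B₁) * (B₂ - C₀ * ⅟A₀ * C₂)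
      - B₀ * ⅟A₀ * (C₂ - B₁ * ⅟(A₁ - C₀ * ⅟A₀ * B₁) * (B₂ - C₀ * ⅟A₀ * C₂)))] :
    block3 A₀ B₁ C₂ C₀ A₁ B₂ B₀ C₁ A₂ *
      block3
        -- A₀' = E₀⁻¹
        (⅟(A₀ - C₂ * ⅟(A₂ - C₁ * ⅟A₁ * B₂) * (B₀ - C₁ * ⅟A₁ * C₀)
          - B₁ * ⅟A₁ * (C₀ - B₂ * ⅟(A₂ - C₁ * ⅟A₁ * B₂) * (B₀ - C₁ * ⅟A₁ * C₀))))
        -- B₁' = -D₀⁻¹ (B₁ - C₂ A₂⁻¹ C₁) A₁'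
        (-(⅟(A₀ - C₂ * ⅟A₂ * B₀) * (B₁ - C₂ * ⅟A₂ * C₁) *
          ⅟(A₁ - C₀ * ⅟(A₀ - C₂ * ⅟A₂ * B₀) * (B₁ - C₂ * ⅟A₂ * C₁)
            - B₂ * ⅟A₂ * (C₁ - B₀ * ⅟(A₀ - C₂ * ⅟A₂ * B₀) * (B₁ - C₂ * ⅟A₂ * C₁)))))
        -- C₂' = -A₀⁻¹ (C₂ - B₁ D₁⁻¹ (B₂ - C₀ A₀⁻¹ C₂)) A₂'
        (-(⅟A₀ * (C₂ - B₁ * ⅟(A₁ - C₀ * ⅟A₀ * B₁) * (B₂ - C₀ * ⅟A₀ * C₂)) *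
          ⅟(A₂ - C₁ * ⅟(A₁ - C₀ * ⅟A₀ * B₁) * (B₂ - C₀ * ⅟A₀ * C₂)
            - B₀ * ⅟A₀ * (C₂ - B₁ * ⅟(A₁ - C₀ * ⅟A₀ * B₁) * (B₂ - C₀ * ⅟A₀ * C₂)))))
        -- C₀' = -A₁⁻¹ (C₀ - B₂ D₂⁻¹ (B₀ - C₁ A₁⁻¹ C₀)) A₀'
        (-(⅟A₁ * (C₀ - B₂ * ⅟(A₂ - C₁ * ⅟A₁ * B₂) * (B₀ - C₁ * ⅟A₁ * C₀)) *
          ⅟(A₀ - C₂ * ⅟(A₂ - C₁ * ⅟A₁ * B₂) * (B₀ - C₁ * ⅟A₁ * C₀)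
            - B₁ * ⅟A₁ * (C₀ - B₂ * ⅟(A₂ - C₁ * ⅟A₁ * B₂) * (B₀ - C₁ * ⅟A₁ * C₀)))))
        -- A₁' = E₁⁻¹
        (⅟(A₁ - C₀ * ⅟(A₀ - C₂ * ⅟A₂ * B₀) * (B₁ - C₂ * ⅟A₂ * C₁)
          - B₂ * ⅟A₂ * (C₁ - B₀ * ⅟(A₀ - C₂ * ⅟A₂ * B₀) * (B₁ - C₂ * ⅟A₂ * C₁))))
        -- B₂' = -D₁⁻¹ (B₂ - C₀ A₀⁻¹ C₂) A₂'
        (-(⅟(A₁ - C₀ * ⅟A₀ * B₁) * (B₂ - C₀ * ⅟A₀ * C₂) *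
          ⅟(A₂ - C₁ * ⅟(A₁ - C₀ * ⅟A₀ * B₁) * (B₂ - C₀ * ⅟A₀ * C₂)
            - B₀ * ⅟A₀ * (C₂ - B₁ * ⅟(A₁ - C₀ * ⅟A₀ * B₁) * (B₂ - C₀ * ⅟A₀ * C₂)))))
        -- B₀' = -D₂⁻¹ (B₀ - C₁ A₁⁻¹ C₀) A₀'
        (-(⅟(A₂ - C₁ * ⅟A₁ * B₂) * (B₀ - C₁ * ⅟A₁ * C₀) *
          ⅟(A₀ - C₂ * ⅟(A₂ - C₁ * ⅟A₁ * B₂) * (B₀ - C₁ * ⅟A₁ * C₀)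
            - B₁ * ⅟A₁ * (C₀ - B₂ * ⅟(A₂ - C₁ * ⅟A₁ * B₂) * (B₀ - C₁ * ⅟A₁ * C₀)))))
        -- C₁' = -A₂⁻¹ (C₁ - B₀ D₀⁻¹ (B₁ - C₂ A₂⁻¹ C₁)) A₁'
        (-(⅟A₂ * (C₁ - B₀ * ⅟(A₀ - C₂ * ⅟A₂ * B₀) * (B₁ - C₂ * ⅟A₂ * C₁)) *
          ⅟(A₁ - C₀ * ⅟(A₀ - C₂ * ⅟A₂ * B₀) * (B₁ - C₂ * ⅟A₂ * C₁)
            - B₂ * ⅟A₂ * (C₁ - B₀ * ⅟(A₀ - C₂ * ⅟A₂ * B₀) * (B₁ - C₂ * ⅟A₂ * C₁)))))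
        -- A₂' = E₂⁻¹
        (⅟(A₂ - C₁ * ⅟(A₁ - C₀ * ⅟A₀ * B₁) * (B₂ - C₀ * ⅟A₀ * C₂)
          - B₀ * ⅟A₀ * (C₂ - B₁ * ⅟(A₁ - C₀ * ⅟A₀ * B₁) * (B₂ - C₀ * ⅟A₀ * C₂)))) = 1 := by
  rw [block3_mul, ← block3_one]
  congr 1
  · exact Matrix.diagonal_row_mul_eq_one ..
  · rw [add_assoc, add_comm]
    exact Matrix.schur_row_mul_eq_zero ..
  · rw [add_comm, ← add_assoc]
    exact Matrix.pivot_row_mul_eq_zero ..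
  · exact Matrix.pivot_row_mul_eq_zero ..
  · rw [add_assoc, add_comm]
    exact Matrix.diagonal_row_mul_eq_one ..
  · rw [add_comm, ← add_assoc]
    exact Matrix.schur_row_mul_eq_zero ..
  · exact Matrix.schur_row_mul_eq_zero ..
  · rw [add_assoc, add_comm]
    exact Matrix.pivot_row_mul_eq_zero ..
  · rw [add_comm, ← add_assoc]
    exact Matrix.diagonal_row_mul_eq_one ..
end

section
/- For n ≥ 2, the 3-exterior algebra Λ₃(ℂⁿ) is infinite-dimensional as a ℂ-vector space. (For instance, already in Λ₃(ℂ²) the elements 1, θ²θ¹, (θ²θ¹)², (θ²θ¹)³, … are linearly independent.) -/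
/-- The defining relations of the 3-exterior algebra: for all generators
`θⁱ, θʲ, θᵏ`, the sum of the products over all six orderings is zero. -/
inductive TriExtRel (K : Type*) [CommRing K] (n : ℕ) :
    FreeAlgebra K (Fin n) → FreeAlgebra K (Fin n) → Prop
  | rel (i j k : Fin n) :
      TriExtRel K n
        (FreeAlgebra.ι K i * FreeAlgebra.ι K j * FreeAlgebra.ι K k +
         FreeAlgebra.ι K j * FreeAlgebra.ι K k * FreeAlgebra.ι K i +
         FreeAlgebra.ι K k * FreeAlgebra.ι K i * FreeAlgebra.ι K j +
         FreeAlgebra.ι K i * FreeAlgebra.ι K k * FreeAlgebra.ι K j +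
         FreeAlgebra.ι K j * FreeAlgebra.ι K i * FreeAlgebra.ι K k +
         FreeAlgebra.ι K k * FreeAlgebra.ι K j * FreeAlgebra.ι K i)
        0

/-- The 3-exterior algebra `Λ₃(Kⁿ)` of Roby: the quotient of the free
associative unital `K`-algebra on `n` generators by the cubic relations. -/
abbrev TriExt (K : Type*) [CommRing K] (n : ℕ) : Type _ :=
  RingQuot (TriExtRel K n)

/-- The image `θⁱ` of the `i`-th generator in `Λ₃(Kⁿ)`. -/
noncomputable def theta (K : Type*) [CommRing K] (n : ℕ) (i : Fin n) :
    TriExt K n :=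
  RingQuot.mkAlgHom K (TriExtRel K n) (FreeAlgebra.ι K i)

/-- A pencil of nilpotent `3 × 3` matrices, linear in `(x, y)`. -/
def nilpotentPencil {R : Type*} [CommRing R] (x y : R) : Matrix (Fin 3) (Fin 3) R :=
  !![0, x, 0; y, 0, x; 0, -y, 0]

/-- The polarization of the identity `nilpotentPencil x y ^ 3 = 0`. -/
theorem nilpotentPencil_sum_perm_eq_zero {R : Type*} [CommRing R] (x₁ y₁ x₂ y₂ x₃ y₃ : R) :
    nilpotentPencil x₁ y₁ * nilpotentPencil x₂ y₂ * nilpotentPencil x₃ y₃ +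
      nilpotentPencil x₂ y₂ * nilpotentPencil x₃ y₃ * nilpotentPencil x₁ y₁ +
      nilpotentPencil x₃ y₃ * nilpotentPencil x₁ y₁ * nilpotentPencil x₂ y₂ +
      nilpotentPencil x₁ y₁ * nilpotentPencil x₃ y₃ * nilpotentPencil x₂ y₂ +
      nilpotentPencil x₂ y₂ * nilpotentPencil x₁ y₁ * nilpotentPencil x₃ y₃ +
      nilpotentPencil x₃ y₃ * nilpotentPencil x₂ y₂ * nilpotentPencil x₁ y₁ = 0 := by
  ext i j
  fin_cases i <;> fin_cases j <;>
    simp [nilpotentPencil] <;> ring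

/-- The representation of `Λ₃(Kⁿ)` sending `θⁱ` to `nilpotentPencil (x i) (y i)`. -/
noncomputable def triExtToMatrix {K R : Type*} [CommRing K] [CommRing R] [Algebra K R] {n : ℕ}
    (x y : Fin n → R) : TriExt K n →ₐ[K] Matrix (Fin 3) (Fin 3) R :=
  RingQuot.liftAlgHom K
    ⟨FreeAlgebra.lift K fun i => nilpotentPencil (x i) (y i), by
      rintro _ _ ⟨i, j, k⟩
      simpa using nilpotentPencil_sum_perm_eq_zero (x i) (y i) (x j) (y j) (x k) (y k)⟩

theorem triExtToMatrix_theta {K R : Type*} [CommRing K] [CommRing R] [Algebra K R] {n : ℕ}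
    (x y : Fin n → R) (i : Fin n) :
    triExtToMatrix x y (theta K n i) = nilpotentPencil (x i) (y i) := by
  simp [triExtToMatrix, theta]

open Polynomial in
/-- In `Λ₃(Kⁿ)` the product of two distinct generators is transcendental over `K`. -/
theorem transcendental_theta_mul_theta (K : Type*) [CommRing K] {n : ℕ} {i j : Fin n}
    (hij : i ≠ j) : Transcendental K (theta K n j * theta K n i) := by
  rw [transcendental_iff]
  intro p hp
  let φ : TriExt K n →ₐ[K] Matrix (Fin 3) (Fin 3) K[X] :=
    triExtToMatrix (Pi.single i 1) (Pi.single j X)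
  have hφ : φ (theta K n j * theta K n i) = Matrix.diagonalAlgHom K ![0, X, -X] := by
    rw [map_mul, triExtToMatrix_theta, triExtToMatrix_theta]
    ext a b
    fin_cases a <;> fin_cases b <;>
      simp [nilpotentPencil, Matrix.mul_apply, Fin.sum_univ_three, hij, hij.symm]
  have h := congrArg φ hp
  rw [map_zero, ← aeval_algHom_apply, hφ, aeval_algHom_apply] at h
  have h₁ := congrFun (congrFun h 1) 1
  rw [Matrix.diagonalAlgHom_apply, Matrix.diagonal_apply_eq, aeval_pi_apply] at h₁
  simpa using h₁

/-- For `n ≥ 2`, the 3-exterior algebra `Λ₃(ℂⁿ)` is infinite-dimensional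
as a `ℂ`-vector space. -/
theorem triExt_not_finiteDimensional (n : ℕ) (hn : 2 ≤ n) :
    ¬ FiniteDimensional ℂ (TriExt ℂ n) := by
  intro _
  have hij : (⟨0, by omega⟩ : Fin n) ≠ ⟨1, by omega⟩ := by simp
  exact transcendental_theta_mul_theta ℂ hij (Algebra.IsAlgebraic.isAlgebraic _)
end

section
/- Let K be a field of characteristic zero (e.g. K = ℂ) and n ≥ 2. In the 3-exterior algebra Λ₃(Kⁿ), the element θ²θ²θ¹ squares to zero: (θ²θ²θ¹)² = 0. -/
/-- The defining relation of the 3-exterior algebra, for the images of the generators. -/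
theorem theta_rel (K : Type*) [CommRing K] (n : ℕ) (i j k : Fin n) :
    theta K n i * theta K n j * theta K n k + theta K n j * theta K n k * theta K n i +
      theta K n k * theta K n i * theta K n j + theta K n i * theta K n k * theta K n j +
      theta K n j * theta K n i * theta K n k + theta K n k * theta K n j * theta K n i = 0 := by
  simpa only [theta, map_add, map_mul, map_zero] using
    RingQuot.mkAlgHom_rel K (TriExtRel.rel (K := K) i j k)

/-- In characteristic zero, the cube of a generator vanishes. -/
theorem theta_cube_eq_zero (K : Type*) [Field K] [CharZero K] (n : ℕ) (i : Fin n) :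
    theta K n i * theta K n i * theta K n i = 0 := by
  have h : (6 : K) • (theta K n i * theta K n i * theta K n i) = 0 := by
    rw [← theta_rel K n i i i]
    module
  exact (smul_eq_zero_iff_right (by norm_num)).mp h

/-- In characteristic zero, the defining relation with a repeated generator can be halved. -/
theorem theta_rel_repeated (K : Type*) [Field K] [CharZero K] (n : ℕ) (i j : Fin n) :
    theta K n i * theta K n j * theta K n j =
      -(theta K n j * theta K n j * theta K n i + theta K n j * theta K n i * theta K n j) := by
  have h : (2 : K) • (theta K n i * theta K n j * theta K n j +
      (theta K n j * theta K n j * theta K n i + theta K n j * theta K n i * theta K n j)) = 0 := by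
    rw [← theta_rel K n i j j]
    module
  exact eq_neg_of_add_eq_zero_left ((smul_eq_zero_iff_right (by norm_num)).mp h)

theorem mul_mul_sq_eq_zero_of_cube_eq_zero {R : Type*} [Ring R] {a b : R}
    (hb : b * b * b = 0) (hab : a * b * b = -(b * b * a + b * a * b)) :
    (b * b * a) ^ 2 = 0 :=
  calc (b * b * a) ^ 2 = b * b * (a * b * b) * a := by noncomm_ring
    _ = -(b * b * b * (b * a * a + a * b * a)) := by rw [hab]; noncomm_ring
    _ = 0 := by rw [hb, zero_mul, neg_zero]

/-- In characteristic zero, the element `θ²θ²θ¹` of the 3-exterior algebra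
squares to zero. -/
theorem theta221_sq_eq_zero (K : Type*) [Field K] [CharZero K] (n : ℕ)
    (hn : 2 ≤ n) :
    (theta K n ⟨1, by omega⟩ * theta K n ⟨1, by omega⟩ *
      theta K n ⟨0, by omega⟩) ^ 2 = 0 := by
  exact mul_mul_sq_eq_zero_of_cube_eq_zero (theta_cube_eq_zero K n _)
    (theta_rel_repeated K n _ _)
end
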